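/- Let d ≥ 2 and let σ_d(t) = d·t on ℝ/ℤ. Let X ⊆ ℝ/ℤ be a finite set with σ_d(X) ⊆ X, and let X' ⊊ X be a proper subset with σ_d(X') ⊆ X'. Then there exist finite sets Y⁰, Y¹ ⊆ ℝ/ℤ, each with at least two elements, and an integer N ≥ 1 such that: (i) X − X' ⊆ Y⁰ ⊆ Y¹ and Y¹ ∩ X' = ∅; (ii) for every closed arc I that is the closure of a connected component of (ℝ/ℤ) − Y¹ there exist integers 0 ≤ n < m, a closed arc J that is the closure of a connected component of (ℝ/ℤ) − Y⁰, and a homeomorphism F_I : I → J with σ_d^n ∘ F_I = σ_d^m on I; (iii) for every a ∈ X − X' and every closure I of a connected component of (ℝ/ℤ) − Y¹ having a as an endpoint, the associated map satisfies F_I(a) = a and m − n = N. -/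

import Mathlib

noncomputable section

open Set

/-- The circle `ℝ/ℤ`. -/
abbrev 𝕊 : Type := AddCircle (1 : ℝ)

/-- The natural projection from `ℝ` to the circle `ℝ/ℤ`. -/
def tc (x : ℝ) : 𝕊 := (x : 𝕊)

/-- The closed arc on the circle from `a` to `b`, traversed in the positive direction;
arcs are parametrized by real lifts `a ≤ b ≤ a + 1` of their endpoints. -/
def cArc (a b : ℝ) : Set 𝕊 := tc '' Set.Icc a b

/-- The open arc on the circle from `a` to `b` (the interior of `cArc a b`). -/
def oArc (a b : ℝ) : Set 𝕊 := tc '' Set.Ioo a b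

/-- The multiplication-by-`d` map `σ_d : ℝ/ℤ → ℝ/ℤ`, `σ_d t = d·t`. -/
def sigmaC (d : ℕ) (x : 𝕊) : 𝕊 := d • x

/-- `a < b` are consecutive elements of `L`. -/
def Consec (L : Set ℝ) (a b : ℝ) : Prop :=
  a ∈ L ∧ b ∈ L ∧ a < b ∧ ∀ x ∈ L, ¬ (a < x ∧ x < b)

lemma continuous_tc : Continuous tc := AddCircle.continuous_mk' 1

lemma tc_surjective : Function.Surjective tc := QuotientAddGroup.mk_surjective

lemma tc_eq_iff {x y : ℝ} : tc x = tc y ↔ ∃ n : ℤ, y = x + n := by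
  rw [eq_comm, ← sub_eq_zero]
  simp only [tc, ← AddCircle.coe_sub, AddCircle.coe_eq_zero_iff]
  refine exists_congr fun n => ?_
  rw [zsmul_one, eq_comm, sub_eq_iff_eq_add']

lemma tc_add_intCast (x : ℝ) (n : ℤ) : tc (x + n) = tc x :=
  (tc_eq_iff.2 ⟨n, rfl⟩).symm

lemma tc_sub_intCast (x : ℝ) (n : ℤ) : tc (x - n) = tc x := by
  rw [← tc_add_intCast (x - n) n, sub_add_cancel]

lemma sigmaC_tc (d : ℕ) (x : ℝ) : sigmaC d (tc x) = tc (d * x) := by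
  simp [sigmaC, tc, ← nsmul_eq_mul]

lemma sigmaC_iterate_tc (d n : ℕ) (x : ℝ) : (sigmaC d)^[n] (tc x) = tc ((d : ℝ) ^ n * x) := by
  induction n with
  | zero => simp
  | succ n ih => rw [Function.iterate_succ_apply', ih, sigmaC_tc, pow_succ', mul_assoc]

lemma tc_injOn {a b : ℝ} (h : b < a + 1) : InjOn tc (Icc a b) := by
  intro x hx y hy hxy
  obtain ⟨n, hn⟩ := tc_eq_iff.1 hxy
  have h1 : (n : ℝ) < 1 := by linarith [hx.1, hy.2]
  have h2 : (-1 : ℝ) < n := by linarith [hx.2, hy.1]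
  have : n = 0 := by
    have h1' : n < 1 := by exact_mod_cast h1
    have h2' : -1 < n := by exact_mod_cast h2
    omega
  simp [hn, this]

lemma finite_lift_inter_Icc {Y : Set 𝕊} (hY : Y.Finite) (a b : ℝ) :
    (tc ⁻¹' Y ∩ Icc a b).Finite := by
  have : tc ⁻¹' Y ∩ Icc a b = ⋃ y ∈ Y, (tc ⁻¹' {y} ∩ Icc a b) := by
    ext x; simp only [mem_inter_iff, mem_preimage, mem_iUnion, mem_singleton_iff, exists_prop]
    exact ⟨fun h => ⟨_, h.1, rfl, h.2⟩, fun ⟨_, h, h', h2⟩ => ⟨h' ▸ h, h2⟩⟩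
  rw [this]
  refine hY.biUnion fun y _ => ?_
  obtain ⟨x, rfl⟩ := tc_surjective y
  refine ((Set.finite_Icc ⌊a - x⌋ ⌈b - x⌉).image fun n : ℤ => x + n).subset ?_
  rintro z ⟨hz, hz'⟩
  obtain ⟨n, rfl⟩ := tc_eq_iff.1 (show tc x = tc z from (mem_singleton_iff.1 hz).symm)
  refine ⟨n, ⟨?_, ?_⟩, rfl⟩
  · exact Int.floor_le_iff.2 (by linarith [hz'.1])
  · exact Int.le_ceil_iff.2 (by linarith [hz'.2])

lemma exists_consec {Y : Set 𝕊} (hY : Y.Finite) (hne : Y.Nonempty) (x : ℝ) :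
    ∃ s t, Consec (tc ⁻¹' Y) s t ∧ s ≤ x ∧ x < t := by
  obtain ⟨y, hy⟩ := hne
  obtain ⟨z, rfl⟩ := tc_surjective y
  have hmem (n : ℤ) : z + n ∈ tc ⁻¹' Y := by
    rw [mem_preimage, tc_add_intCast]; exact hy
  obtain ⟨s, ⟨hsL, hs⟩, hsmax⟩ := Set.exists_max_image _ id (finite_lift_inter_Icc hY (x - 1) x)
    ⟨z + ⌊x - z⌋, hmem _, by linarith [Int.lt_floor_add_one (x - z)],
      by linarith [Int.floor_le (x - z)]⟩
  obtain ⟨t, ⟨⟨htL, ht⟩, hxt⟩, htmin⟩ := Set.exists_min_image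
    ((tc ⁻¹' Y ∩ Icc x (x + 1)) ∩ Ioi x) id ((finite_lift_inter_Icc hY x (x + 1)).inter_of_left _)
    ⟨z + (⌊x - z⌋ + 1 : ℤ), ⟨hmem _, by push_cast; linarith [Int.lt_floor_add_one (x - z)],
      by push_cast; linarith [Int.floor_le (x - z)]⟩,
      by push_cast; simp only [mem_Ioi]; linarith [Int.lt_floor_add_one (x - z)]⟩
  simp only [mem_Ioi] at hxt
  refine ⟨s, t, ⟨hsL, htL, by linarith [hs.2], ?_⟩, hs.2, hxt⟩
  rintro w hw ⟨h1, h2⟩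
  rcases le_or_gt w x with h | h
  · have := hsmax w ⟨hw, by linarith [hs.1], h⟩
    simp only [id] at this
    linarith
  · have := htmin w ⟨⟨hw, h.le, by linarith [ht.2]⟩, h⟩
    simp only [id] at this
    linarith

lemma Consec.le_add_one {Y : Set 𝕊} {a b : ℝ} (h : Consec (tc ⁻¹' Y) a b) : b ≤ a + 1 := by
  by_contra! hlt
  refine h.2.2.2 (a + 1) ?_ ⟨by linarith, hlt⟩
  have := tc_add_intCast a 1
  rw [mem_preimage]
  push_cast at this
  rw [this]
  exact h.1

lemma Consec.lt_add_one {Y : Set 𝕊} (hY : Y.Nontrivial) {a b : ℝ}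
    (h : Consec (tc ⁻¹' Y) a b) : b < a + 1 := by
  refine lt_of_le_of_ne h.le_add_one fun hb => ?_
  obtain ⟨y, hy, hya⟩ := hY.exists_ne (tc a)
  obtain ⟨z, rfl⟩ := tc_surjective y
  have hz : tc (z - ⌊z - a⌋) = tc z := tc_sub_intCast _ _
  refine h.2.2.2 (z - ⌊z - a⌋) (by rw [mem_preimage, hz]; exact hy) ⟨?_, ?_⟩
  · refine lt_of_le_of_ne (by linarith [Int.floor_le (z - a)]) fun h' => hya ?_
    rw [← hz, ← h']
  · linarith [Int.lt_floor_add_one (z - a)]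

lemma closure_connectedComponentIn {Y : Set 𝕊} {a b x : ℝ}
    (h : Consec (tc ⁻¹' Y) a b) (hx : x ∈ Ioo a b) :
    closure (connectedComponentIn Yᶜ (tc x)) = tc '' Icc a b := by
  have hclosed : IsClosed (tc '' Icc a b) := (isCompact_Icc.image continuous_tc).isClosed
  have hopen : IsOpen (tc '' Ioo a b) := QuotientAddGroup.isOpenMap_coe _ isOpen_Ioo
  have hsub : tc '' Ioo a b ⊆ Yᶜ := by
    rintro _ ⟨z, hz, rfl⟩ hzY
    exact h.2.2.2 z hzY hz
  have hcomp : connectedComponentIn Yᶜ (tc x) = tc '' Ioo a b := by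
    apply Subset.antisymm
    · refine isPreconnected_connectedComponentIn.subset_left_of_subset_union hopen
        hclosed.isOpen_compl ?_ ?_ ⟨tc x, mem_connectedComponentIn (hsub ⟨x, hx, rfl⟩),
          ⟨x, hx, rfl⟩⟩
      · exact disjoint_compl_right_iff_subset.2 (image_mono Ioo_subset_Icc_self)
      · intro y hy
        by_cases hy' : y ∈ tc '' Icc a b
        · obtain ⟨z, hz, rfl⟩ := hy'
          have hzY : tc z ∉ Y := connectedComponentIn_subset _ _ hy
          refine Or.inl ⟨z, ⟨lt_of_le_of_ne hz.1 ?_, lt_of_le_of_ne hz.2 ?_⟩, rfl⟩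
          · rintro rfl; exact hzY h.1
          · rintro rfl; exact hzY h.2.1
        · exact Or.inr hy'
    · exact (isPreconnected_Ioo.image _ continuous_tc.continuousOn).subset_connectedComponentIn
        ⟨x, hx, rfl⟩ hsub
  rw [hcomp]
  apply Subset.antisymm
  · exact closure_minimal (image_mono Ioo_subset_Icc_self) hclosed
  · rw [← closure_Ioo h.2.2.1.ne]
    exact image_closure_subset_closure_image continuous_tc

/-- The homeomorphism of a real segment of length less than one onto its image in the circle. -/
def arcHomeomorph {a b : ℝ} (h : b < a + 1) : Icc a b ≃ₜ (tc '' Icc a b) :=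
  Continuous.homeoOfEquivCompactToT2 (f := Equiv.Set.imageOfInjOn tc (Icc a b) (tc_injOn h))
    ((continuous_tc.comp continuous_subtype_val).subtype_mk _)

lemma coe_arcHomeomorph {a b : ℝ} (h : b < a + 1) (x : Icc a b) :
    (arcHomeomorph h x : 𝕊) = tc x := rfl

lemma exists_affine_arc_homeomorph {a b a' b' r c : ℝ} (hr : 0 < r) (hab : b < a + 1)
    (hab' : b' < a' + 1) (ha : r * a + c = a') (hb : r * b + c = b') :
    ∃ F : (tc '' Icc a b) ≃ₜ (tc '' Icc a' b'), ∀ (x : ℝ) (hx : x ∈ Icc a b),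
      (F ⟨tc x, x, hx, rfl⟩ : 𝕊) = tc (r * x + c) := by
  have himg : affineHomeomorph r c hr.ne' '' Icc a b = Icc a' b' := by
    subst ha hb
    exact image_affine_Icc' hr c a b
  let G : Icc a b ≃ₜ Icc a' b' :=
    ((affineHomeomorph r c hr.ne').image (Icc a b)).trans (Homeomorph.setCongr himg)
  refine ⟨((arcHomeomorph hab).symm.trans G).trans (arcHomeomorph hab'), fun x hx => ?_⟩
  have : (arcHomeomorph hab).symm ⟨tc x, x, hx, rfl⟩ = ⟨x, hx⟩ := by
    rw [Homeomorph.symm_apply_eq]; rfl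
  simp only [Homeomorph.trans_apply, this, coe_arcHomeomorph]
  rfl

/-- The interval `[a, b]` is carried onto a gap of `L` by an affine map `x ↦ d ^ k * x + c` with
`k ≥ 1` and `c ∈ ℤ[1/d]`, where `k = N` and the map fixes (modulo `1`) those of `a`, `b` which
belong to `L`. -/
def IsGapPullback (d N : ℕ) (L : Set ℝ) (a b : ℝ) : Prop :=
  ∃ (k n : ℕ) (c : ℝ), 1 ≤ k ∧ (∃ z : ℤ, (d : ℝ) ^ n * c = z) ∧
    Consec L (d ^ k * a + c) (d ^ k * b + c) ∧
    (a ∈ L → tc (d ^ k * a + c) = tc a ∧ k = N) ∧ (b ∈ L → tc (d ^ k * b + c) = tc b ∧ k = N)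

/-- `S` is the set of endpoints of a tiling of `[p, q]` by gap pullbacks, avoiding `Z`. -/
structure IsTiling (d N : ℕ) (L Z : Set ℝ) (p q : ℝ) (S : Set ℝ) : Prop where
  finite : S.Finite
  subset : S ⊆ Icc p q
  left_mem : p ∈ S
  right_mem : q ∈ S
  disjoint : ∀ x ∈ S, x ∉ Z
  pullback : ∀ a b, Consec S a b → IsGapPullback d N L a b

lemma IsTiling.union {d N : ℕ} {L Z : Set ℝ} {p q r : ℝ} {S T : Set ℝ}
    (hS : IsTiling d N L Z p q S) (hT : IsTiling d N L Z q r T) :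
    IsTiling d N L Z p r (S ∪ T) where
  finite := hS.finite.union hT.finite
  subset := union_subset
    (hS.subset.trans (Icc_subset_Icc_right (hT.subset hT.left_mem).2))
    (hT.subset.trans (Icc_subset_Icc_left (hS.subset hS.right_mem).1))
  left_mem := Or.inl hS.left_mem
  right_mem := Or.inr hT.right_mem
  disjoint x hx := hx.elim (hS.disjoint x) (hT.disjoint x)
  pullback a b h := by
    obtain ⟨ha, hb, hab, h⟩ := h
    have hS' (x : ℝ) (hx : x ∈ S ∪ T) (hxq : x ≤ q) : x ∈ S := by
      rcases hx with hx | hx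
      · exact hx
      · rw [le_antisymm hxq (hT.subset hx).1]; exact hS.right_mem
    have hT' (x : ℝ) (hx : x ∈ S ∪ T) (hxq : q ≤ x) : x ∈ T := by
      rcases hx with hx | hx
      · rw [← le_antisymm hxq (hS.subset hx).2]; exact hT.left_mem
      · exact hx
    rcases le_or_gt b q with hbq | hbq
    · exact hS.pullback a b ⟨hS' a ha (hab.le.trans hbq), hS' b hb hbq, hab,
        fun x hx => h x (Or.inl hx)⟩
    · have haq : q ≤ a := by
        by_contra! haq
        exact h q (Or.inl hS.right_mem) ⟨haq, hbq⟩
      exact hT.pullback a b ⟨hT' a ha haq, hT' b hb hbq.le, hab, fun x hx => h x (Or.inr hx)⟩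

lemma isTiling_affine {d N k n : ℕ} (hd : 2 ≤ d) (hk : 1 ≤ k) {Y : Set 𝕊} (hY : Y.Finite)
    {Z : Set ℝ} {p q c : ℝ} (hpq : p ≤ q) (hc : ∃ z : ℤ, (d : ℝ) ^ n * c = z)
    (hp : tc (d ^ k * p + c) ∈ Y) (hq : tc (d ^ k * q + c) ∈ Y)
    (hZ : ∀ x ∈ Icc p q, x ∈ Z → tc (d ^ k * x + c) ∉ Y)
    (hfix : ∀ x ∈ Icc p q, tc x ∈ Y → tc (d ^ k * x + c) = tc x ∧ k = N) :
    IsTiling d N (tc ⁻¹' Y) Z p q (Icc p q ∩ {x | tc (d ^ k * x + c) ∈ Y}) where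
  finite := by
    have hpos : (0 : ℝ) < d ^ k := by positivity
    refine Finite.of_finite_image
      ((finite_lift_inter_Icc hY (d ^ k * p + c) (d ^ k * q + c)).subset ?_)
      (f := fun x => (d : ℝ) ^ k * x + c) ?_
    · rintro _ ⟨x, ⟨⟨h1, h2⟩, hx⟩, rfl⟩
      exact ⟨hx, by dsimp only; gcongr, by dsimp only; gcongr⟩
    · intro x _ y _ hxy
      simpa [hpos.ne', show d ≠ 0 by omega] using hxy
  subset := inter_subset_left
  left_mem := ⟨left_mem_Icc.2 hpq, hp⟩
  right_mem := ⟨right_mem_Icc.2 hpq, hq⟩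
  disjoint x hx hxZ := hZ x hx.1 hxZ hx.2
  pullback a b h := by
    have hpos : (0 : ℝ) < d ^ k := by positivity
    obtain ⟨ha, hb, hab, h⟩ := h
    refine ⟨k, n, c, hk, hc, ⟨ha.2, hb.2, by gcongr, ?_⟩, hfix a ha.1, hfix b hb.1⟩
    rintro y hy ⟨h1, h2⟩
    have hy' : d ^ k * ((y - c) / d ^ k) + c = y := by field_simp; ring
    have h1' : a < (y - c) / d ^ k := by rw [lt_div_iff₀ hpos]; linarith
    have h2' : (y - c) / d ^ k < b := by rw [div_lt_iff₀ hpos]; linarith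
    refine h _ ⟨⟨ha.1.1.trans h1'.le, h2'.le.trans hb.1.2⟩, ?_⟩ ⟨h1', h2'⟩
    rw [mem_ofPred_eq, hy']
    exact hy

/-- Tilings of the gaps of `tc ⁻¹' Y` over one period glue to a global tiling of the circle. -/
lemma exists_refinement {d N : ℕ} {Y : Set 𝕊} (hY : Y.Finite) (hne : Y.Nonempty) (X' : Set 𝕊)
    (h : ∀ s t, Consec (tc ⁻¹' Y) s t → ∃ S, IsTiling d N (tc ⁻¹' Y) (tc ⁻¹' X') s t S) :
    ∃ Y1 : Set 𝕊, Y1.Finite ∧ Y ⊆ Y1 ∧ Disjoint Y1 X' ∧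
      ∀ a b, Consec (tc ⁻¹' Y1) a b → IsGapPullback d N (tc ⁻¹' Y) a b := by
  choose S hS using h
  let P : Set (ℝ × ℝ) := {p | Consec (tc ⁻¹' Y) p.1 p.2 ∧ 0 ≤ p.1 ∧ p.1 < 1}
  have hP : P.Finite := by
    refine ((finite_lift_inter_Icc hY 0 2).prod (finite_lift_inter_Icc hY 0 2)).subset ?_
    rintro ⟨s, t⟩ ⟨hst, h0, h1⟩
    have := hst.le_add_one
    have := hst.2.2.1
    dsimp only at *
    exact ⟨⟨hst.1, by dsimp only; linarith, by dsimp only; linarith⟩,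
      ⟨hst.2.1, by dsimp only; linarith, by dsimp only; linarith⟩⟩
  let Y1 : Set 𝕊 := ⋃ p : P, tc '' S p.1.1 p.1.2 p.2.1
  have : Finite P := hP
  have htr (n : ℤ) (x : ℝ) : x - n ∈ tc ⁻¹' Y ↔ x ∈ tc ⁻¹' Y := by
    rw [mem_preimage, tc_sub_intCast, mem_preimage]
  have htr' (n : ℤ) (x : ℝ) : x + n ∈ tc ⁻¹' Y ↔ x ∈ tc ⁻¹' Y := by
    rw [mem_preimage, tc_add_intCast, mem_preimage]
  have htr1 (n : ℤ) (x : ℝ) : x - n ∈ tc ⁻¹' Y1 ↔ x ∈ tc ⁻¹' Y1 := by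
    rw [mem_preimage, tc_sub_intCast, mem_preimage]
  have hshift {s t : ℝ} (hst : Consec (tc ⁻¹' Y) s t) : (s - ⌊s⌋, t - ⌊s⌋) ∈ P := by
    refine ⟨⟨(htr _ _).2 hst.1, (htr _ _).2 hst.2.1, by dsimp only; linarith [hst.2.2.1], ?_⟩,
      by dsimp only; linarith [Int.floor_le s], by dsimp only; linarith [Int.lt_floor_add_one s]⟩
    rintro x hx ⟨h1, h2⟩
    exact hst.2.2.2 (x + ⌊s⌋) ((htr' _ _).2 hx)
      ⟨by dsimp only at h1; linarith, by dsimp only at h2; linarith⟩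
  have hsub : Y ⊆ Y1 := by
    intro y hy
    obtain ⟨x, rfl⟩ := tc_surjective y
    obtain ⟨s, t, hst, hsx, hxt⟩ := exists_consec hY hne x
    have hxs : x = s := by
      by_contra hxs
      exact hst.2.2.2 x hy ⟨lt_of_le_of_ne hsx (Ne.symm hxs), hxt⟩
    subst hxs
    exact mem_iUnion.2 ⟨⟨_, hshift hst⟩, x - ⌊x⌋, (hS _ _ _).left_mem, tc_sub_intCast _ _⟩
  have hinter (p : P) : tc ⁻¹' Y1 ∩ Icc p.1.1 p.1.2 = S p.1.1 p.1.2 p.2.1 := by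
    obtain ⟨⟨s, t⟩, hst, h0, h1⟩ := p
    dsimp only at *
    refine Subset.antisymm ?_ fun x hx =>
      ⟨mem_iUnion.2 ⟨⟨_, hst, h0, h1⟩, x, hx, rfl⟩, (hS _ _ _).subset hx⟩
    rintro x ⟨hx, hsx, hxt⟩
    rcases hsx.eq_or_lt with rfl | hsx
    · exact (hS _ _ _).left_mem
    rcases hxt.eq_or_lt with rfl | hxt
    · exact (hS _ _ _).right_mem
    obtain ⟨⟨⟨s', t'⟩, hst', h0', h1'⟩, x', hx', hxx'⟩ := mem_iUnion.1 hx
    dsimp only at *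
    obtain ⟨n, rfl⟩ := tc_eq_iff.1 hxx'
    have hb := (hS _ _ _).subset hx'
    have e1 : s' + n ≤ s := by
      by_contra! hlt
      exact hst.2.2.2 _ ((htr' n s').2 hst'.1) ⟨hlt, by linarith [hb.1]⟩
    have e2 : s ≤ s' + n := by
      by_contra! hlt
      exact hst'.2.2.2 _ ((htr n s).2 hst.1) ⟨by linarith, by linarith [hb.2]⟩
    have e3 : t' + n ≤ t := by
      by_contra! hlt
      exact hst'.2.2.2 _ ((htr n t).2 hst.2.1) ⟨by linarith [hb.1], by linarith⟩
    have e4 : t ≤ t' + n := by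
      by_contra! hlt
      exact hst.2.2.2 _ ((htr' n t').2 hst'.2.1) ⟨by linarith [hb.2], hlt⟩
    have hn : n = 0 := by
      have h2 : (n : ℝ) < 1 := by linarith
      have h3 : (-1 : ℝ) < n := by linarith
      have h2' : n < 1 := by exact_mod_cast h2
      have h3' : -1 < n := by exact_mod_cast h3
      omega
    subst hn
    have es : s' = s := by push_cast at *; linarith
    have et : t' = t := by push_cast at *; linarith
    subst es et
    simpa using hx'
  refine ⟨Y1, finite_iUnion fun p => ((hS _ _ _).finite.image _), hsub, ?_, ?_⟩
  · rw [Set.disjoint_left]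
    rintro y hy
    obtain ⟨p, x, hx, rfl⟩ := mem_iUnion.1 hy
    exact (hS _ _ _).disjoint x hx
  · rintro a b ⟨ha, hb, hab, hcons⟩
    obtain ⟨s, t, hst, hsa, hat⟩ := exists_consec hY hne a
    have hbt : b ≤ t := by
      by_contra! hlt
      exact hcons t (hsub hst.2.1) ⟨hat, hlt⟩
    have hp := hinter ⟨_, hshift hst⟩
    dsimp only at hp
    obtain ⟨k, n, c, hk, ⟨z, hz⟩, hG, hfa, hfb⟩ := (hS _ _ (hshift hst).1).pullback
        (a - ⌊s⌋) (b - ⌊s⌋) (by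
      rw [← hp]
      refine ⟨⟨(htr1 _ _).2 ha, by linarith, by linarith⟩,
        ⟨(htr1 _ _).2 hb, by linarith, by linarith⟩, by linarith, ?_⟩
      rintro x hx ⟨h1, h2⟩
      refine hcons (x + ⌊s⌋) ((htr1 ⌊s⌋ _).1 ?_) ⟨by linarith, by linarith⟩
      rw [add_sub_cancel_right]
      exact hx.1)
    have e (x : ℝ) : (d : ℝ) ^ k * (x - ⌊s⌋) + c = d ^ k * x + (c - d ^ k * ⌊s⌋) := by ring
    rw [e, htr, tc_sub_intCast] at hfa hfb
    rw [e, e] at hG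
    refine ⟨k, n, c - d ^ k * ⌊s⌋, hk, ⟨z - d ^ n * d ^ k * ⌊s⌋, ?_⟩, hG, hfa, hfb⟩
    push_cast
    rw [← hz]
    ring

lemma eventually_tc_notMem {Y : Set 𝕊} (hY : Y.Finite) (z : ℝ) :
    ∀ᶠ w in nhdsWithin z {z}ᶜ, tc w ∉ Y := by
  have hF : ((tc ⁻¹' Y ∩ Icc (z - 1) (z + 1)) \ {z}).Finite :=
    (finite_lift_inter_Icc hY _ _).sdiff
  have h1 : ((tc ⁻¹' Y ∩ Icc (z - 1) (z + 1)) \ {z})ᶜ ∈ nhds z :=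
    hF.isClosed.isOpen_compl.mem_nhds (by simp)
  have h2 : Icc (z - 1) (z + 1) ∈ nhds z := Icc_mem_nhds (by linarith) (by linarith)
  filter_upwards [mem_nhdsWithin_of_mem_nhds h1, mem_nhdsWithin_of_mem_nhds h2,
    self_mem_nhdsWithin] with w hw1 hw2 hw3 hwY
  exact hw1 ⟨⟨hwY, hw2⟩, hw3⟩

lemma eventually_tc_sub_notMem {Y : Set 𝕊} (hY : Y.Finite) {F : Set ℝ} (hF : F.Finite)
    {u : ℕ → ℝ} (hu : Filter.Tendsto u Filter.atTop (nhds 0)) (hu0 : ∀ i, u i ≠ 0) :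
    ∀ᶠ i in Filter.atTop, ∀ x ∈ F, tc (x - u i) ∉ Y := by
  rw [Filter.eventually_all_finite hF]
  intro x _
  have : Filter.Tendsto (fun i => x - u i) Filter.atTop (nhdsWithin x {x}ᶜ) := by
    refine tendsto_nhdsWithin_iff.2 ⟨by simpa using hu.const_sub x, .of_forall fun i => ?_⟩
    simpa using hu0 i
  exact this.eventually (eventually_tc_notMem hY x)

set_option maxHeartbeats 1600000 in
/-- A gap `[s, t]` admits a tiling whose two extreme tiles are the contractions of `[s, t]` by
`d ^ N` towards `s` and towards `t`. -/
lemma exists_isTiling {d N M : ℕ} (hd : 2 ≤ d) (hN : 1 ≤ N) {Y X' : Set 𝕊} (hY : Y.Finite)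
    (hX' : X'.Finite) {δ : ℝ} (hδ : 0 < δ) (hδN : 4 < δ * d ^ N)
    (hper : ∀ y, tc y ∈ Y → ∃ z : ℤ, (d : ℝ) ^ M * ((d ^ N - 1) * y) = z)
    (hsep : ∀ x y, tc x ∈ X' → tc y ∈ Y → δ ≤ |x - y|) {s t : ℝ}
    (hst : Consec (tc ⁻¹' Y) s t) (hgap : δ ≤ t - s) :
    ∃ S, IsTiling d N (tc ⁻¹' Y) (tc ⁻¹' X') s t S := by
  obtain ⟨κ, hκ, hκM⟩ : ∃ κ : ℕ, (∀ x ∈ tc ⁻¹' X' ∩ Icc s t,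
      tc ((d : ℝ) ^ N * x + -((d ^ N - 1) * s) - ((d : ℝ) ^ (N * κ))⁻¹) ∉ Y) ∧ M ≤ κ := by
    have h1 : 1 < (d : ℝ) ^ N := one_lt_pow₀ (by exact_mod_cast hd) (by omega)
    have hu : Filter.Tendsto (fun κ : ℕ => ((d : ℝ) ^ (N * κ))⁻¹) Filter.atTop (nhds 0) := by
      simp_rw [pow_mul]
      exact (tendsto_pow_atTop_atTop_of_one_lt h1).inv_tendsto_atTop
    have := eventually_tc_sub_notMem hY ((finite_lift_inter_Icc hX' s t).image
      fun x => (d : ℝ) ^ N * x + -((d ^ N - 1) * s)) hu (fun i => by positivity)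
    obtain ⟨κ, h2, h3⟩ := (this.and (Filter.eventually_ge_atTop M)).exists
    exact ⟨κ, fun x hx => h2 _ ⟨x, hx, rfl⟩, h3⟩
  obtain ⟨hs, ht, hlt, hcons⟩ := id hst
  obtain ⟨zs, hzs⟩ := hper s hs
  obtain ⟨zt, hzt⟩ := hper t ht
  have hle1 := hst.le_add_one
  obtain ⟨w, hw⟩ : ∃ w : ℤ, (d : ℝ) ^ (N * κ) - 1 = (d ^ N - 1) * w := by
    obtain ⟨w, hw⟩ := sub_one_dvd_pow_sub_one ((d : ℤ) ^ N) κ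
    exact ⟨w, by rw [pow_mul]; exact_mod_cast hw⟩
  obtain ⟨f, hf⟩ : ∃ f, N * κ = M + f :=
    ⟨N * κ - M, by have := Nat.le_mul_of_pos_left κ hN; omega⟩
  have hQZ : (0 : ℤ) < d ^ (N * κ) := by positivity
  obtain ⟨k', g, hk'Q, hj⟩ : ∃ (k' : ℕ) (g : ℤ), (k' : ℤ) < d ^ (N * κ) ∧
      (d : ℤ) ^ f * (zt - zs) - 1 = d ^ (N * κ) * g + k' := by
    refine ⟨((d ^ f * (zt - zs) - 1) % (d : ℤ) ^ (N * κ)).toNat,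
      (d ^ f * (zt - zs) - 1) / (d : ℤ) ^ (N * κ), ?_, ?_⟩
    · rw [Int.toNat_of_nonneg (Int.emod_nonneg _ hQZ.ne')]
      exact Int.emod_lt_of_pos _ hQZ
    · rw [Int.toNat_of_nonneg (Int.emod_nonneg _ hQZ.ne'), Int.mul_ediv_add_emod]
  have hjR : (d : ℝ) ^ (N * κ) * ((d ^ N - 1) * (t - s)) - 1 = d ^ (N * κ) * g + k' := by
    have : (d : ℝ) ^ f * (zt - zs) - 1 = d ^ (N * κ) * g + k' := by exact_mod_cast hj
    rw [← this, hf, pow_add, ← hzs, ← hzt]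
    ring
  have hk'R : (k' : ℝ) < d ^ (N * κ) := by exact_mod_cast hk'Q
  have hk'0 : (0 : ℝ) ≤ k' := k'.cast_nonneg
  have hpowQ : (d : ℝ) ^ (N + N * κ) = d ^ N * d ^ (N * κ) := pow_add _ _ _
  have hQn : (d : ℝ) ^ (M + N * κ) = d ^ M * d ^ (N * κ) := pow_add _ _ _
  have hQ1 : 1 ≤ (d : ℝ) ^ (N * κ) := one_le_pow₀ (by exact_mod_cast (by omega : 1 ≤ d))
  have hD1 : 1 < (d : ℝ) ^ N := one_lt_pow₀ (by exact_mod_cast hd) (by omega)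
  have hMQ : ∃ z : ℤ, (d : ℝ) ^ M = z := ⟨d ^ M, by push_cast; rfl⟩
  have hQint : ∃ z : ℤ, (d : ℝ) ^ (N * κ) = z := ⟨d ^ (N * κ), by push_cast; rfl⟩
  obtain ⟨zM, hzM⟩ := hMQ
  obtain ⟨zQ, hzQ⟩ := hQint
  set D : ℝ := (d : ℝ) ^ N with hD
  set Q : ℝ := (d : ℝ) ^ (N * κ) with hQ
  have hD0 : 0 < D := by linarith
  have hQ0 : 0 < Q := by linarith
  obtain ⟨p1, hp1⟩ : ∃ p1, p1 = s + (t - s) / D := ⟨_, rfl⟩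
  obtain ⟨p2, hp2⟩ : ∃ p2, p2 = p1 + 1 / (D * Q) := ⟨_, rfl⟩
  obtain ⟨p4, hp4⟩ : ∃ p4, p4 = t - (t - s) / D := ⟨_, rfl⟩
  obtain ⟨p3, hp3⟩ : ∃ p3, p3 = p4 - k' / (D * Q) := ⟨_, rfl⟩
  have hDp1 : D * p1 = D * s + (t - s) := by rw [hp1]; field_simp
  have hDp4 : D * p4 = D * t - (t - s) := by rw [hp4]; field_simp
  have hDp2 : D * Q * p2 = Q * (D * p1) + 1 := by rw [hp2]; field_simp
  have hDp3 : D * Q * p3 = Q * (D * p4) - k' := by rw [hp3]; field_simp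
  have hinvD : 2 / D < δ / 2 := by
    rw [div_lt_iff₀ hD0]; linarith
  have htsD : (t - s) / D ≤ 1 / D := by gcongr; linarith
  have htsD0 : 0 < (t - s) / D := div_pos (by linarith) hD0
  have h1DQ : 1 / (D * Q) ≤ 1 / D := by gcongr; nlinarith
  have h1DQ0 : 0 < 1 / (D * Q) := by positivity
  have hkDQ : k' / (D * Q) ≤ 1 / D := by
    rw [div_le_div_iff₀ (by positivity) hD0]; nlinarith
  have hkDQ0 : 0 ≤ k' / (D * Q) := by positivity
  have h2D : 2 / D = 1 / D + 1 / D := by ring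
  have hsp1 : s < p1 := by linarith
  have hp12 : p1 < p2 := by linarith
  have hp2s : p2 < s + δ / 2 := by linarith
  have hp34 : p3 ≤ p4 := by linarith
  have hp4t : p4 < t := by linarith
  have hp3t : t - δ / 2 < p3 := by linarith
  have hp23 : p2 < p3 := by linarith
  have hleft (x : ℝ) (hx1 : s ≤ x) (hx2 : x ≤ p2) : x ∉ tc ⁻¹' X' := by
    intro hx
    have := hsep x s hx hs
    rw [abs_of_nonneg (by linarith)] at this
    linarith
  have hright (x : ℝ) (hx1 : p3 ≤ x) (hx2 : x ≤ t) : x ∉ tc ⁻¹' X' := by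
    intro hx
    have := hsep x t hx ht
    rw [abs_of_nonpos (by linarith)] at this
    linarith
  have hmid {x : ℝ} {P : Prop} (hx1 : s < x) (hx2 : x < t) (hx : tc x ∈ Y) : P :=
    (hcons x hx ⟨hx1, hx2⟩).elim
  have hsY : tc s ∈ Y := hs
  have htY : tc t ∈ Y := ht
  have T1 := isTiling_affine (N := N) (k := N) (n := M) (c := -((D - 1) * s)) hd hN hY
    (Z := tc ⁻¹' X') (p := s) (q := p1) hsp1.le
    ⟨-zs, by push_cast; linarith⟩
    (by rw [← hD]; convert hsY using 2; ring)
    (by rw [← hD, hDp1]; convert htY using 2; ring)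
    (fun x hx hx' => (hleft x hx.1 (by linarith [hx.2]) hx').elim)
    (fun x hx hxY => by
      rcases hx.1.eq_or_lt with rfl | hlt
      · rw [← hD]
        exact ⟨congrArg tc (by ring), rfl⟩
      · exact hmid hlt (by linarith [hx.2]) hxY)
  have T2 := isTiling_affine (N := N) (k := N + N * κ) (n := M) (c := -((D - 1) * (w * t + Q * s)))
    hd (by omega) hY (Z := tc ⁻¹' X') (p := p1) (q := p2) hp12.le
    ⟨-(w * zt + zQ * zs), by
      push_cast; rw [← hzs, ← hzt, ← hzQ]; ring⟩
    (by rw [hpowQ]; convert htY using 2; linear_combination Q * hDp1 + t * hw)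
    (by
      rw [hpowQ, ← tc_sub_intCast _ 1]
      convert htY using 2
      push_cast
      linear_combination hDp2 + Q * hDp1 + t * hw)
    (fun x hx hx' => (hleft x (by linarith [hx.1]) hx.2 hx').elim)
    (fun x hx hxY => hmid (by linarith [hx.1]) (by linarith [hx.2]) hxY)
  have T3 := isTiling_affine (N := N) (k := N) (n := M + N * κ) (c := -((D - 1) * s) - Q⁻¹)
    hd hN hY (Z := tc ⁻¹' X') (p := p2) (q := p3) hp23.le
    ⟨-(zQ * zs) - zM, by
      push_cast; rw [hQn, ← hzs, ← hzQ, ← hzM]; field_simp⟩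
    (by
      rw [← hD]
      convert htY using 2
      field_simp
      linear_combination hDp2 + Q * hDp1)
    (by
      rw [← hD, ← tc_sub_intCast _ g]
      convert hsY using 2
      field_simp
      linear_combination hDp3 + Q * hDp4 + hjR)
    (fun x hx hx' => by
      rw [← hD, ← add_sub_assoc]
      exact hκ x ⟨hx', by linarith [hx.1], by linarith [hx.2]⟩)
    (fun x hx hxY => hmid (by linarith [hx.1]) (by linarith [hx.2]) hxY)
  have T4 := isTiling_affine (N := N) (k := N + N * κ) (n := M) (c := -((D - 1) * (w * s + Q * t)))
    hd (by omega) hY (Z := tc ⁻¹' X') (p := p3) (q := p4) hp34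
    ⟨-(w * zs + zQ * zt), by
      push_cast; rw [← hzs, ← hzt, ← hzQ]; ring⟩
    (by
      rw [hpowQ, ← tc_add_intCast _ k']
      convert hsY using 2
      push_cast
      linear_combination hDp3 + Q * hDp4 + s * hw)
    (by rw [hpowQ]; convert hsY using 2; linear_combination Q * hDp4 + s * hw)
    (fun x hx hx' => (hright x hx.1 (by linarith [hx.2]) hx').elim)
    (fun x hx hxY => hmid (by linarith [hx.1]) (by linarith [hx.2]) hxY)
  have T5 := isTiling_affine (N := N) (k := N) (n := M) (c := -((D - 1) * t)) hd hN hY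
    (Z := tc ⁻¹' X') (p := p4) (q := t) hp4t.le
    ⟨-zt, by push_cast; linarith⟩
    (by rw [← hD, hDp4]; convert hsY using 2; ring)
    (by rw [← hD]; convert htY using 2; ring)
    (fun x hx hx' => (hright x (by linarith [hx.1]) hx.2 hx').elim)
    (fun x hx hxY => by
      rcases hx.2.eq_or_lt with rfl | hlt
      · rw [← hD]
        exact ⟨congrArg tc (by ring), rfl⟩
      · exact hmid (by linarith [hx.1]) hlt hxY)
  exact ⟨_, (((T1.union T2).union T3).union T4).union T5⟩

lemma exists_common_period (d R : ℕ) {X : Set 𝕊} (hX : X.Finite)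
    (hinv : sigmaC d '' X ⊆ X) :
    ∃ M N : ℕ, R ≤ N ∧ ∀ x, tc x ∈ X → ∃ z : ℤ, (d : ℝ) ^ M * ((d ^ N - 1) * x) = z := by
  have : Finite X := hX
  let f : X → X := fun x => ⟨sigmaC d x, hinv ⟨x, x.2, rfl⟩⟩
  have hf (n : ℕ) (x : X) : (f^[n] x : 𝕊) = (sigmaC d)^[n] x :=
    Function.Semiconj.iterate_right (f := Subtype.val) (fun _ => rfl) n x
  obtain ⟨i, j, hij, h⟩ : ∃ i j : ℕ, i < j ∧ f^[i * R] = f^[j * R] := by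
    obtain ⟨i, j, hij, h⟩ := Finite.exists_ne_map_eq_of_infinite fun n : ℕ => f^[n * R]
    rcases hij.lt_or_gt with h' | h'
    · exact ⟨i, j, h', h⟩
    · exact ⟨j, i, h', h.symm⟩
  obtain ⟨l, rfl⟩ := Nat.exists_eq_add_of_lt hij
  refine ⟨i * R, (l + 1) * R, Nat.le_mul_of_pos_left R (by omega), fun x hx => ?_⟩
  have h1 := congrArg Subtype.val (congrFun h ⟨tc x, hx⟩)
  rw [hf, hf, sigmaC_iterate_tc, sigmaC_iterate_tc, tc_eq_iff] at h1
  obtain ⟨z, hz⟩ := h1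
  refine ⟨z, ?_⟩
  rw [show (i + l + 1) * R = i * R + (l + 1) * R by ring, pow_add] at hz
  linear_combination hz

lemma exists_pos_le_dist_of_finite {Y : Set 𝕊} (hY : Y.Finite) :
    ∃ δ > 0, ∀ x y, tc x ∈ Y → tc y ∈ Y → tc x ≠ tc y → δ ≤ |x - y| := by
  rcases Y.subsingleton_or_nontrivial with hs | hn
  · exact ⟨1, one_pos, fun x y hx hy hxy => (hxy (hs hx hy)).elim⟩
  · refine ⟨Y.infsep, hY.infsep_pos_iff_nontrivial.2 hn, fun x y hx hy hxy => ?_⟩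
    refine (infsep_le_dist_of_mem hx hy hxy).trans ?_
    rw [dist_eq_norm, ← Real.norm_eq_abs]
    exact QuotientAddGroup.norm_mk_le_norm (m := x - y)

lemma exists_arc_homeomorph {d N : ℕ} (hd : 1 ≤ d) {Y0 Y1 : Set 𝕊} (hY1 : Y1.Finite)
    (h0 : Y0.Nontrivial) (h01 : Y0 ⊆ Y1)
    (h : ∀ a b, Consec (tc ⁻¹' Y1) a b → IsGapPullback d N (tc ⁻¹' Y0) a b) (I : Set 𝕊)
    (hI : ∃ x ∉ Y1, I = closure (connectedComponentIn Y1ᶜ x)) :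
    ∃ (n m : ℕ) (J : Set 𝕊), n < m ∧
      (∃ y ∉ Y0, J = closure (connectedComponentIn Y0ᶜ y)) ∧
      ∃ F : ↥I ≃ₜ ↥J,
        (∀ x : ↥I, (sigmaC d)^[n] (F x : 𝕊) = (sigmaC d)^[m] ↑x) ∧
        (∀ (a : 𝕊) (ha : a ∈ I), a ∈ Y0 → ((F ⟨a, ha⟩ : 𝕊) = a ∧ m - n = N)) := by
  obtain ⟨x, hx, rfl⟩ := hI
  obtain ⟨x, rfl⟩ := tc_surjective x
  have h1 := h0.mono h01
  obtain ⟨a, b, hab, hax, hxb⟩ := exists_consec hY1 h1.nonempty x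
  have hax' : a < x := lt_of_le_of_ne hax (by rintro rfl; exact hx hab.1)
  rw [closure_connectedComponentIn hab ⟨hax', hxb⟩]
  obtain ⟨k, n, c, hk, ⟨z, hz⟩, hG, hfa, hfb⟩ := h a b hab
  have hdk : (0 : ℝ) < d ^ k := by positivity
  obtain ⟨F, hF⟩ := exists_affine_arc_homeomorph hdk (hab.lt_add_one h1)
    (hG.lt_add_one h0) rfl rfl
  obtain ⟨y, hy⟩ := exists_between hG.2.2.1
  refine ⟨n, n + k, _, by omega, ⟨tc y, fun hyY => hG.2.2.2 y hyY hy,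
    (closure_connectedComponentIn hG hy).symm⟩, F, ?_, ?_⟩
  · rintro ⟨_, w, hw, rfl⟩
    rw [hF w hw, sigmaC_iterate_tc, sigmaC_iterate_tc, mul_add, hz, tc_add_intCast, pow_add, mul_assoc]
  · rintro _ ⟨w, hw, rfl⟩ hwY
    rw [hF w hw, Nat.add_sub_cancel_left]
    rcases hw.1.eq_or_lt with rfl | hw1
    · exact hfa hwY
    rcases hw.2.eq_or_lt with rfl | hw2
    · exact hfb hwY
    exact (hab.2.2.2 w (h01 hwY) ⟨hw1, hw2⟩).elim

lemma exists_markov_refinement {d : ℕ} (hd : 2 ≤ d) {X X' : Set 𝕊} (hfin : X.Finite)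
    (hXinv : sigmaC d '' X ⊆ X) (hX' : X' ⊆ X) (hnt : (X \ X').Nontrivial) :
    ∃ (Y1 : Set 𝕊) (N : ℕ), Y1.Finite ∧ 1 ≤ N ∧ X \ X' ⊆ Y1 ∧ Disjoint Y1 X' ∧
      ∀ a b, Consec (tc ⁻¹' Y1) a b → IsGapPullback d N (tc ⁻¹' (X \ X')) a b := by
  obtain ⟨δ, hδ, hsep⟩ := exists_pos_le_dist_of_finite hfin
  obtain ⟨R, hR⟩ := exists_nat_gt (4 / δ)
  obtain ⟨M, N, hRN, hper⟩ := exists_common_period d (R + 1) hfin hXinv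
  have hYfin : (X \ X').Finite := hfin.sdiff
  have hδN : 4 < δ * d ^ N := by
    have h1 : (N : ℝ) < d ^ N := by exact_mod_cast Nat.lt_pow_self (by omega)
    have h2 : (R : ℝ) ≤ N := by exact_mod_cast (by omega : R ≤ N)
    rw [div_lt_iff₀ hδ] at hR
    nlinarith
  obtain ⟨Y1, hfin1, hsub, hdisj, h⟩ := exists_refinement (d := d) (N := N) hYfin hnt.nonempty X'
    fun s t hst => exists_isTiling hd (by omega) hYfin (hfin.subset hX') hδ hδN
      (fun y hy => hper y hy.1) (fun x y hx hy => hsep x y (hX' hx) hy.1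
        (fun hxy => hy.2 (hxy ▸ hx))) hst (by
      have hlt := hst.2.2.1
      rw [← abs_of_pos (sub_pos.2 hlt)]
      refine hsep t s hst.2.1.1 hst.1.1 fun hts => hlt.ne' ?_
      exact tc_injOn (hst.lt_add_one hnt) (right_mem_Icc.2 hlt.le) (left_mem_Icc.2 hlt.le) hts)
  exact ⟨Y1, N, hfin1, by omega, hsub, hdisj, h⟩

lemma exists_ne_sigmaC_eq {d : ℕ} (hd : 2 ≤ d) (a : 𝕊) : ∃ b ≠ a, sigmaC d b = a := by
  obtain ⟨x, rfl⟩ := tc_surjective a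
  have hd0 : (d : ℝ) ≠ 0 := by positivity
  have hd2 : (2 : ℝ) ≤ d := by exact_mod_cast hd
  have h1 : sigmaC d (tc (x / d)) = tc x := by
    rw [sigmaC_tc, mul_div_cancel₀ _ hd0]
  have h2 : sigmaC d (tc (x / d + 1 / d)) = tc x := by
    rw [sigmaC_tc, mul_add, mul_div_cancel₀ _ hd0, mul_div_cancel₀ _ hd0]
    simpa using tc_add_intCast x 1
  have hne : tc (x / d) ≠ tc (x / d + 1 / d) := by
    intro h
    have hpos : (0 : ℝ) < 1 / d := by positivity
    have hlt : (1 : ℝ) / d < 1 := by rw [div_lt_one (by linarith)]; linarith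
    have := tc_injOn (a := x / d) (b := x / d + 1 / d) (by linarith)
      (left_mem_Icc.2 (by linarith)) (right_mem_Icc.2 (by linarith)) h
    linarith
  by_cases h : tc (x / d) = tc x
  · exact ⟨_, fun h' => hne (h.trans h'.symm), h2⟩
  · exact ⟨_, h, h1⟩

/-- Let `d ≥ 2`, let `X ⊆ ℝ/ℤ` be a finite set invariant under `σ_d`, and let `X' ⊊ X` be a
proper invariant subset. Then there exist finite sets `Y⁰ ⊆ Y¹` (each with at least two
elements) and `N ≥ 1` such that: `X − X' ⊆ Y⁰`, `Y¹ ∩ X' = ∅`; every closed arc `I` that is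
the closure of a connected component of `(ℝ/ℤ) − Y¹` admits integers `0 ≤ n < m`, a closed
arc `J` that is the closure of a connected component of `(ℝ/ℤ) − Y⁰`, and a homeomorphism
`F_I : I → J` with `σ_d^n ∘ F_I = σ_d^m` on `I`; and whenever `a ∈ X − X'` is an endpoint of
such an `I`, the associated map satisfies `F_I a = a` and `m − n = N`. -/
theorem modified_contact_markov (d : ℕ) (hd : 2 ≤ d) (X X' : Set 𝕊) (hfin : X.Finite)
    (hXinv : sigmaC d '' X ⊆ X) (hX' : X' ⊂ X) (hX'inv : sigmaC d '' X' ⊆ X') :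
    ∃ (Y0 Y1 : Set 𝕊) (N : ℕ),
      Y0.Finite ∧ Y1.Finite ∧ Y0.Nontrivial ∧ Y1.Nontrivial ∧ 1 ≤ N ∧
      X \ X' ⊆ Y0 ∧ Y0 ⊆ Y1 ∧ Y1 ∩ X' = ∅ ∧
      ∀ I : Set 𝕊, (∃ x ∉ Y1, I = closure (connectedComponentIn Y1ᶜ x)) →
        ∃ (n m : ℕ) (J : Set 𝕊), n < m ∧
          (∃ y ∉ Y0, J = closure (connectedComponentIn Y0ᶜ y)) ∧
          ∃ F : ↥I ≃ₜ ↥J,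
            (∀ x : ↥I, (sigmaC d)^[n] (F x : 𝕊) = (sigmaC d)^[m] ↑x) ∧
            (∀ (a : 𝕊) (ha : a ∈ I), a ∈ X \ X' →
              ((F ⟨a, ha⟩ : 𝕊) = a ∧ m - n = N)) := by
  obtain ⟨a, haX, haX'⟩ := exists_of_ssubset hX'
  obtain ⟨b, hba, hb⟩ := exists_ne_sigmaC_eq hd a
  have hbX' : b ∉ X' := fun h => haX' (hb ▸ hX'inv ⟨b, h, rfl⟩)
  have hinv : sigmaC d '' insert b X ⊆ insert b X := by
    rw [image_insert_eq, hb]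
    exact insert_subset (Or.inr haX) (hXinv.trans (subset_insert _ _))
  have hnt : (insert b X \ X').Nontrivial :=
    ⟨b, ⟨Or.inl rfl, hbX'⟩, a, ⟨Or.inr haX, haX'⟩, hba⟩
  obtain ⟨Y1, N, hfin1, hN, hsub, hdisj, h⟩ := exists_markov_refinement hd (hfin.insert b) hinv
    (hX'.subset.trans (subset_insert _ _)) hnt
  have hXY : X \ X' ⊆ insert b X \ X' := sdiff_subset_sdiff_left (subset_insert _ _)
  refine ⟨insert b X \ X', Y1, N, (hfin.insert b).sdiff, hfin1, hnt, hnt.mono hsub, hN, hXY, hsub,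
    hdisj.inter_eq, fun I hI => ?_⟩
  obtain ⟨n, m, J, hnm, hJ, F, hF, hfix⟩ := exists_arc_homeomorph (by omega) hfin1 hnt hsub h I hI
  exact ⟨n, m, J, hnm, hJ, F, hF, fun a ha haX => hfix a ha (hXY haX)⟩
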